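/- arXiv:math/0410082 — 4 statements merged into one kernel-verified Lean document; each statement's English description precedes it below -/
import Mathlib

section
/- Let P ∈ ℤ[X,Y], let b ∈ ℤ and let ℓ be a natural number. Define f : ℂ → ℂ by f(z) = P(e^z, e^{bz}). If f vanishes to order ℓ at 0 (that is, f^{(h)}(0) = 0 for every integer h with 0 ≤ h < ℓ), then (1/ℓ!)·f^{(ℓ)}(0) is a rational integer. -/
open Finset Polynomial in
/-- If the power sums `∑ c i * k i ^ h` vanish for `h < ℓ`, then `ℓ!` divides the `ℓ`-th one. -/
theorem factorial_dvd_sum_mul_pow {ι : Type*} (s : Finset ι) (c k : ι → ℤ) (ℓ : ℕ)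
    (h0 : ∀ h < ℓ, ∑ i ∈ s, c i * k i ^ h = 0) :
    (ℓ.factorial : ℤ) ∣ ∑ i ∈ s, c i * k i ^ ℓ := by
  have hL : ∑ i ∈ s, c i * (descPochhammer ℤ ℓ).eval (k i) = ∑ i ∈ s, c i * k i ^ ℓ := by
    simp_rw [eval_eq_sum_range, descPochhammer_natDegree, Finset.mul_sum]
    rw [Finset.sum_comm, Finset.sum_range_succ, Finset.sum_eq_zero, zero_add]
    · have hcoeff : (descPochhammer ℤ ℓ).coeff ℓ = 1 := by
        simpa [Monic, leadingCoeff] using monic_descPochhammer ℤ ℓ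
      simp [hcoeff]
    · intro h hh
      simp_rw [mul_left_comm _ ((descPochhammer ℤ ℓ).coeff h)]
      rw [← Finset.mul_sum, h0 h (Finset.mem_range.mp hh), mul_zero]
  rw [← hL]
  refine Finset.dvd_sum fun i _ => Dvd.dvd.mul_left ⟨Ring.choose (k i) ℓ, ?_⟩ _
  simpa [eval_eq_smeval] using Ring.descPochhammer_eq_factorial_smul_choose (k i) ℓ

/-- Iterated derivatives of an exponential sum. -/
theorem iteratedDeriv_sum_mul_cexp {ι : Type*} (s : Finset ι) (c k : ι → ℂ) (n : ℕ) :
    iteratedDeriv n (fun z => ∑ i ∈ s, c i * Complex.exp (k i * z)) =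
      fun z => ∑ i ∈ s, c i * k i ^ n * Complex.exp (k i * z) := by
  induction n with
  | zero => simp
  | succ n ih =>
    rw [iteratedDeriv_succ, ih]
    funext z
    refine (HasDerivAt.fun_sum fun i _ =>
      (((hasDerivAt_id z).const_mul (k i)).cexp.const_mul (c i * k i ^ n))).deriv.trans ?_
    refine Finset.sum_congr rfl fun i _ => ?_
    simp only [id]
    ring

/-- Fact 2.1: let `P ∈ ℤ[X,Y]`, `b ∈ ℤ` and `ℓ ∈ ℕ`.  If the entire function
`f(z) = P(e^z, e^{bz})` vanishes to order `ℓ` at `0`, then `(1/ℓ!)·f^{(ℓ)}(0)` is a rational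
integer. -/
theorem taylor_coeff_is_integer (P : MvPolynomial (Fin 2) ℤ) (b : ℤ) (ℓ : ℕ)
    (f : ℂ → ℂ)
    (hf : ∀ z : ℂ, f z = MvPolynomial.aeval ![Complex.exp z, Complex.exp (b * z)] P)
    (hvanish : ∀ h : ℕ, h < ℓ → iteratedDeriv h f 0 = 0) :
    ∃ N : ℤ, (1 / (ℓ.factorial : ℂ)) * iteratedDeriv ℓ f 0 = (N : ℂ) := by
  set k : (Fin 2 →₀ ℕ) → ℤ := fun m => m 0 + b * m 1 with hk
  have hsum : f = fun z => ∑ m ∈ P.support, ((P.coeff m : ℤ) : ℂ) * Complex.exp ((k m : ℂ) * z) := by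
    funext z
    rw [hf, MvPolynomial.aeval_def, MvPolynomial.eval₂_eq']
    refine Finset.sum_congr rfl fun m _ => ?_
    simp only [Fin.prod_univ_two, Matrix.cons_val_zero, Matrix.cons_val_one, ← Complex.exp_nat_mul,
      ← Complex.exp_add, hk, algebraMap_int_eq, eq_intCast]
    push_cast
    ring_nf
  have hderiv (h : ℕ) :
      iteratedDeriv h f 0 = ((∑ m ∈ P.support, P.coeff m * k m ^ h : ℤ) : ℂ) := by
    rw [hsum, iteratedDeriv_sum_mul_cexp]
    simp
  obtain ⟨N, hN⟩ := factorial_dvd_sum_mul_pow P.support P.coeff k ℓ fun h hh => by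
    exact_mod_cast (hderiv h).symm.trans (hvanish h hh)
  refine ⟨N, ?_⟩
  have hfact : (ℓ.factorial : ℂ) ≠ 0 := by exact_mod_cast ℓ.factorial_ne_zero
  rw [hderiv, hN]
  push_cast
  field_simp
end

section
/- Let P = ∑_{(i,j)} p_{ij} X^i Y^j ∈ ℤ[X,Y] (finite sum, p_{ij} ∈ ℤ), let b ∈ ℤ and let ℓ be a natural number. Define f : ℂ → ℂ by f(z) = P(e^z, e^{bz}). If f^{(h)}(0) = 0 for every integer h with 0 ≤ h < ℓ, then (1/ℓ!)·f^{(ℓ)}(0) = ∑_{(i,j)} p_{ij} Δ_ℓ(i + jb), where Δ_ℓ is the ℓ-th binomial polynomial; in particular this value is a rational integer. -/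
/-- The `n`-th binomial polynomial `Δ_n(X) = X(X+1)⋯(X+n−1)/n!` (with `Δ₀ = 1`). -/
noncomputable def binomialPoly (n : ℕ) : Polynomial ℚ :=
  (n.factorial : ℚ)⁻¹ • ascPochhammer ℚ n

open Finset in
/-- If the power sums `∑ c i * x i ^ h` vanish for `h < n`, then a polynomial of degree at most `n`
only contributes its `n`-th coefficient to `∑ c i * Q(x i)`. -/
theorem Polynomial.sum_mul_eval_eq_coeff_mul_sum_pow {ι R : Type*} [CommSemiring R]
    (s : Finset ι) (c x : ι → R) {n : ℕ} (hvanish : ∀ h < n, ∑ i ∈ s, c i * x i ^ h = 0)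
    {Q : Polynomial R} (hQ : Q.natDegree ≤ n) :
    ∑ i ∈ s, c i * Q.eval (x i) = Q.coeff n * ∑ i ∈ s, c i * x i ^ n := by
  have hexpand : ∑ i ∈ s, c i * Q.eval (x i) =
      ∑ h ∈ range (n + 1), Q.coeff h * ∑ i ∈ s, c i * x i ^ h := by
    simp_rw [Polynomial.eval_eq_sum_range' (Nat.lt_succ_of_le hQ), mul_sum]
    rw [sum_comm]
    exact sum_congr rfl fun _ _ => sum_congr rfl fun _ _ => mul_left_comm _ _ _
  rw [hexpand, sum_range_succ, sum_eq_zero, zero_add]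
  intro h hh
  rw [hvanish h (mem_range.mp hh), mul_zero]

theorem natDegree_binomialPoly_le (n : ℕ) : (binomialPoly n).natDegree ≤ n :=
  (Polynomial.natDegree_smul_le _ _).trans (ascPochhammer_natDegree ℚ n).le

theorem coeff_binomialPoly_self (n : ℕ) : (binomialPoly n).coeff n = (n.factorial : ℚ)⁻¹ := by
  have h : (ascPochhammer ℚ n).coeff n = 1 := by
    simpa [Polynomial.Monic, Polynomial.leadingCoeff, ascPochhammer_natDegree] using
      monic_ascPochhammer ℚ n
  simp [binomialPoly, h]

theorem binomialPoly_eval_intCast (n : ℕ) (m : ℤ) :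
    (binomialPoly n).eval (m : ℚ) = (Ring.multichoose m n : ℤ) := by
  have h := Ring.factorial_nsmul_multichoose_eq_ascPochhammer m n
  rw [Polynomial.ascPochhammer_smeval_eq_eval, nsmul_eq_mul] at h
  have hn : (n.factorial : ℚ) ≠ 0 := by positivity
  have hcast : (ascPochhammer ℚ n).eval (m : ℚ) = ((ascPochhammer ℤ n).eval m : ℤ) := by
    rw [← ascPochhammer_map (Int.castRingHom ℚ) n]
    exact Polynomial.eval_intCast_map (Int.castRingHom ℚ) _ m
  rw [binomialPoly, Polynomial.eval_smul, hcast, ← h, smul_eq_mul]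
  push_cast
  field_simp

/-- The derivatives at the origin of an exponential sum are its power sums. -/
theorem iteratedDeriv_sum_mul_cexp_zero {ι : Type*} (s : Finset ι) (c x : ι → ℂ) (n : ℕ) :
    iteratedDeriv n (fun z => ∑ i ∈ s, c i * Complex.exp (x i * z)) 0 =
      ∑ i ∈ s, c i * x i ^ n := by
  rw [iteratedDeriv_fun_sum fun i _ => by fun_prop]
  refine Finset.sum_congr rfl fun i _ => ?_
  rw [iteratedDeriv_const_mul_field, iteratedDeriv_cexp_const_mul]
  simp

theorem MvPolynomial.aeval_exp_exp (P : MvPolynomial (Fin 2) ℤ) (b : ℤ) (z : ℂ) :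
    MvPolynomial.aeval ![Complex.exp z, Complex.exp (b * z)] P =
      ∑ μ ∈ P.support, ((MvPolynomial.coeff μ P : ℤ) : ℂ) *
        Complex.exp (((μ 0 : ℂ) + (μ 1 : ℂ) * (b : ℂ)) * z) := by
  rw [MvPolynomial.aeval_def, MvPolynomial.eval₂_eq']
  refine Finset.sum_congr rfl fun μ _ => ?_
  simp only [Fin.prod_univ_two, Matrix.cons_val_zero, Matrix.cons_val_one, ← Complex.exp_nat_mul,
    ← Complex.exp_add, algebraMap_int_eq, eq_intCast]
  ring_nf

/-- Let `P = ∑ p_{ij} X^i Y^j ∈ ℤ[X,Y]`, `b ∈ ℤ`, `ℓ ∈ ℕ`, and `f(z) = P(e^z, e^{bz})`.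
If `f^{(h)}(0) = 0` for all `0 ≤ h < ℓ`, then
`(1/ℓ!)·f^{(ℓ)}(0) = ∑_{(i,j)} p_{ij} Δ_ℓ(i + jb)`; in particular this value is a rational
integer. -/
theorem taylor_coeff_eq_sum_binomial (P : MvPolynomial (Fin 2) ℤ) (b : ℤ) (ℓ : ℕ)
    (f : ℂ → ℂ)
    (hf : ∀ z : ℂ, f z = MvPolynomial.aeval ![Complex.exp z, Complex.exp (b * z)] P)
    (hvanish : ∀ h : ℕ, h < ℓ → iteratedDeriv h f 0 = 0) :
    (1 / (ℓ.factorial : ℂ)) * iteratedDeriv ℓ f 0 =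
      ((∑ μ ∈ P.support, ((MvPolynomial.coeff μ P : ℤ) : ℚ) *
          (binomialPoly ℓ).eval ((μ 0 : ℚ) + (μ 1 : ℚ) * (b : ℚ)) : ℚ) : ℂ) ∧
    ∃ N : ℤ, (1 / (ℓ.factorial : ℂ)) * iteratedDeriv ℓ f 0 = (N : ℂ) := by
  have hderiv (h : ℕ) : iteratedDeriv h f 0 = ((∑ μ ∈ P.support,
      ((MvPolynomial.coeff μ P : ℤ) : ℚ) * ((μ 0 : ℚ) + (μ 1 : ℚ) * (b : ℚ)) ^ h : ℚ) : ℂ) := by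
    rw [funext fun z => (hf z).trans (MvPolynomial.aeval_exp_exp P b z),
      iteratedDeriv_sum_mul_cexp_zero]
    push_cast
    rfl
  have hsum := Polynomial.sum_mul_eval_eq_coeff_mul_sum_pow P.support
    (fun μ => ((MvPolynomial.coeff μ P : ℤ) : ℚ)) (fun μ => (μ 0 : ℚ) + (μ 1 : ℚ) * (b : ℚ))
    (fun h hh => by exact_mod_cast (hderiv h).symm.trans (hvanish h hh))
    (natDegree_binomialPoly_le ℓ)
  have hmain : (1 / (ℓ.factorial : ℂ)) * iteratedDeriv ℓ f 0 =
      ((∑ μ ∈ P.support, ((MvPolynomial.coeff μ P : ℤ) : ℚ) *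
          (binomialPoly ℓ).eval ((μ 0 : ℚ) + (μ 1 : ℚ) * (b : ℚ)) : ℚ) : ℂ) := by
    rw [hsum, coeff_binomialPoly_self, hderiv, one_div, Rat.cast_mul, Rat.cast_inv,
      Rat.cast_natCast]
  refine ⟨hmain, ∑ μ ∈ P.support,
    MvPolynomial.coeff μ P * Ring.multichoose ((μ 0 : ℤ) + (μ 1 : ℤ) * b) ℓ, ?_⟩
  refine hmain.trans (Eq.trans (congrArg (Rat.cast : ℚ → ℂ) ?_) (Rat.cast_intCast _))
  rw [Int.cast_sum]
  refine Finset.sum_congr rfl fun μ _ => ?_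
  rw [Int.cast_mul, ← binomialPoly_eval_intCast]
  push_cast
  rfl
end

section
/- Let p be a prime number, let S₁ and T₁ be positive integers and let R ≥ r ≥ 1 be real numbers. Set κ = (S₁ − σ_p(S₁))/(p − 1) + ⌊log S₁ / log p⌋, where σ_p(S₁) is the sum of the digits of S₁ in base p. Let f : {z ∈ ℂ_p : |z| ≤ R} → ℂ_p be an analytic function. Then |f|_r / r^{(S₁+1)T₁} ≤ p^{κ T₁} · max{ max_{0 ≤ m ≤ S₁, 0 ≤ h < T₁} |(1/h!)·f^{(h)}(m)| , (1/R)^{(S₁+1)T₁}·|f|_R }. -/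
open Filter Topology

theorem summable_mul_pow_of_tendsto {K : Type*} [NormedField K] [IsUltrametricDist K]
    [CompleteSpace K] {R : ℝ} {a : ℕ → K} (ha : Tendsto (fun n => ‖a n‖ * R ^ n) atTop (𝓝 0))
    {b : ℕ → K} (hb : ∀ n, ‖b n‖ ≤ R ^ n) : Summable fun n => a n * b n := by
  refine NonarchimedeanAddGroup.summable_of_tendsto_cofinite_zero ?_
  rw [Nat.cofinite_eq_atTop]
  refine squeeze_zero_norm (fun n => ?_) ha
  rw [norm_mul]
  exact mul_le_mul_of_nonneg_left (hb n) (norm_nonneg _)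

theorem norm_natCast_eq_norm_padic {p : ℕ} [Fact p.Prime] {K : Type*} [NormedField K]
    [Algebra ℚ_[p] K] (hiso : ∀ x : ℚ_[p], ‖algebraMap ℚ_[p] K x‖ = ‖x‖) (n : ℕ) :
    ‖(n : K)‖ = ‖(n : ℚ_[p])‖ := by
  rw [← hiso, map_natCast]

theorem IsPrimitiveRoot.sum_range_pow_mul {K : Type*} [Field K] {M : ℕ} {ζ : K}
    (hζ : IsPrimitiveRoot ζ M) (l : ℕ) :
    ∑ i ∈ Finset.range M, (ζ ^ i) ^ l = if M ∣ l then (M : K) else 0 := by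
  simp_rw [fun i => pow_right_comm ζ i l]
  split_ifs with h
  · simp [(hζ.pow_eq_one_iff_dvd l).2 h]
  · have h1 : ζ ^ l ≠ 1 := fun h' => h ((hζ.pow_eq_one_iff_dvd l).1 h')
    rw [geom_sum_eq h1, ← pow_right_comm, hζ.pow_eq_one, one_pow, sub_self, zero_div]

theorem norm_coeff_mul_pow_le_of_forall_sphere {p : ℕ} [Fact p.Prime] {K : Type*} [NormedField K]
    [IsUltrametricDist K] [CompleteSpace K] [IsAlgClosed K] [Algebra ℚ_[p] K]
    (hiso : ∀ x : ℚ_[p], ‖algebraMap ℚ_[p] K x‖ = ‖x‖) {a : ℕ → K} {c : K}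
    (ha : Tendsto (fun n => ‖a n‖ * ‖c‖ ^ n) atTop (𝓝 0)) {B : ℝ}
    (hB : ∀ z : K, ‖z‖ = ‖c‖ → ‖∑' n, a n * z ^ n‖ ≤ B) (n : ℕ) :
    ‖a n‖ * ‖c‖ ^ n ≤ B := by
  have : CharZero K := charZero_of_injective_algebraMap (algebraMap ℚ_[p] K).injective
  have hp := (Fact.out : p.Prime)
  refine le_of_forall_pos_le_add fun ε hε => ?_
  have hB0 : 0 ≤ B := (norm_nonneg _).trans (hB c rfl)
  obtain ⟨N, hN⟩ := eventually_atTop.1 (ha.eventually (gt_mem_nhds hε))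
  set M := p * (N + n + 1) + 1 with hM
  have hMN : N + n + 1 ≤ M := by nlinarith [hp.one_lt]
  obtain ⟨ζ, hζ⟩ := HasEnoughRootsOfUnity.exists_primitiveRoot K M
  have hMnorm : ‖(M : K)‖ = 1 := by
    rw [norm_natCast_eq_norm_padic hiso, Padic.norm_natCast_eq_one_iff, hM]
    simp
  have hζ1 : ‖ζ‖ = 1 := by
    have := congrArg norm hζ.pow_eq_one
    rw [norm_pow, norm_one] at this
    exact (pow_eq_one_iff_of_nonneg (norm_nonneg _) (by omega)).1 this
  have hnorm : ∀ i, ‖c * ζ ^ i‖ = ‖c‖ := fun i => by simp [hζ1]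
  have hsum : ∀ i, Summable fun k => a k * (c * ζ ^ i) ^ k := fun i =>
    summable_mul_pow_of_tendsto ha fun k => by rw [norm_pow, hnorm]
  set t : ℕ → K := fun k => a k * c ^ k * if M ∣ k + (M - n) then (M : K) else 0 with ht
  have key : HasSum t (∑ i ∈ Finset.range M, (ζ ^ i) ^ (M - n) * ∑' k, a k * (c * ζ ^ i) ^ k) := by
    have := hasSum_sum (s := Finset.range M) fun i _ =>
      ((hsum i).hasSum.mul_left ((ζ ^ i) ^ (M - n)))
    refine (funext fun k => ?_ : t = _) ▸ this
    simp only [ht]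
    rw [← hζ.sum_range_pow_mul, Finset.mul_sum]
    refine Finset.sum_congr rfl fun i _ => ?_
    rw [mul_pow, pow_add]
    ring
  have hle : ‖∑' k, t k‖ ≤ B := by
    rw [key.tsum_eq]
    refine IsUltrametricDist.norm_sum_le_of_forall_le_of_nonneg hB0 fun i _ => ?_
    simpa [hζ1] using hB _ (hnorm i)
  have htn : ‖t n‖ = ‖a n‖ * ‖c‖ ^ n := by
    have : n + (M - n) = M := by omega
    simp [ht, this, hMnorm]
  have hrest : ‖∑' k, if k = n then 0 else t k‖ ≤ ε := by
    refine IsUltrametricDist.norm_tsum_le_of_forall_le_of_nonneg hε.le fun k => ?_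
    split_ifs with hk
    · simpa using hε.le
    · rw [ht]
      simp only
      split_ifs with hd
      · have : N ≤ k := by
          by_contra! hlt
          obtain ⟨q, hq⟩ := hd
          have h1 : 0 < q := by
            rcases Nat.eq_zero_or_pos q with h | h
            · subst h; omega
            · exact h
          have h2 : q < 2 := by
            by_contra! h2
            have := Nat.mul_le_mul_left M h2
            omega
          obtain rfl : q = 1 := by omega
          omega
        simpa [hMnorm] using (hN k this).le
      · simpa using hε.le
  have heq := key.summable.tsum_eq_add_tsum_ite n
  have : t n = ∑' k, t k - ∑' k, (if k = n then 0 else t k) := by rw [heq]; ring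
  rw [← htn, this]
  rw [sub_eq_add_neg]
  refine (IsUltrametricDist.norm_add_le_max _ _).trans (max_le (by linarith) ?_)
  rw [norm_neg]
  linarith

theorem exists_norm_mem_Ioc {p : ℕ} [Fact p.Prime] {K : Type*} [NormedField K]
    [IsAlgClosed K] [Algebra ℚ_[p] K]
    (hiso : ∀ x : ℚ_[p], ‖algebraMap ℚ_[p] K x‖ = ‖x‖) {ρ R : ℝ} (hρ : 0 < ρ) (hR : ρ < R) :
    ∃ c : K, ρ < ‖c‖ ∧ ‖c‖ ≤ R := by
  have hp : (1 : ℝ) < p := by exact_mod_cast (Fact.out : p.Prime).one_lt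
  have hR0 := hρ.trans hR
  obtain ⟨n, hn⟩ := pow_unbounded_of_one_lt (p : ℝ) ((one_lt_div hρ).2 hR)
  have hn0 : n ≠ 0 := by
    rintro rfl
    rw [pow_zero] at hn
    exact hn.not_gt hp
  obtain ⟨k, hk1, hk2⟩ := exists_mem_Ico_zpow (pow_pos hR0 n) hp
  obtain ⟨c, hc⟩ := IsAlgClosed.exists_pow_nat_eq
    (algebraMap ℚ_[p] K ((p : ℚ_[p]) ^ (-k))) (Nat.pos_of_ne_zero hn0)
  have hcn : ‖c‖ ^ n = (p : ℝ) ^ k := by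
    rw [← norm_pow, hc, hiso, Padic.norm_p_zpow, neg_neg]
  refine ⟨c, lt_of_pow_lt_pow_left₀ n (norm_nonneg c) ?_,
    le_of_pow_le_pow_left₀ hn0 hR0.le (hcn ▸ hk1)⟩
  rw [hcn]
  rw [div_pow, lt_div_iff₀ (pow_pos hρ n)] at hn
  rw [zpow_add_one₀ (by positivity)] at hk2
  nlinarith

theorem norm_coeff_mul_pow_le_of_forall_closedBall {p : ℕ} [Fact p.Prime] {K : Type*}
    [NormedField K] [IsUltrametricDist K] [CompleteSpace K] [IsAlgClosed K] [Algebra ℚ_[p] K]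
    (hiso : ∀ x : ℚ_[p], ‖algebraMap ℚ_[p] K x‖ = ‖x‖) {a : ℕ → K} {R : ℝ} (hR : 0 < R)
    (ha : Tendsto (fun n => ‖a n‖ * R ^ n) atTop (𝓝 0)) {B : ℝ}
    (hB : ∀ z : K, ‖z‖ ≤ R → ‖∑' n, a n * z ^ n‖ ≤ B) (n : ℕ) :
    ‖a n‖ * R ^ n ≤ B := by
  have hcont : Tendsto (fun ρ : ℝ => ‖a n‖ * ρ ^ n) (𝓝[<] R) (𝓝 (‖a n‖ * R ^ n)) :=
    ((continuous_const.mul (continuous_id.pow n)).tendsto R).mono_left nhdsWithin_le_nhds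
  refine le_of_tendsto hcont ?_
  filter_upwards [Ioo_mem_nhdsLT hR] with ρ hρ
  obtain ⟨c, hc1, hc2⟩ := exists_norm_mem_Ioc (K := K) hiso hρ.1 hρ.2
  have hρ0 := hρ.1.le
  calc ‖a n‖ * ρ ^ n ≤ ‖a n‖ * ‖c‖ ^ n := by gcongr
    _ ≤ B := by
      refine norm_coeff_mul_pow_le_of_forall_sphere hiso ?_ (fun z hz => hB z (hz ▸ hc2)) n
      exact squeeze_zero (fun k => by positivity) (fun k => by gcongr) ha

theorem PowerSeries.norm_coeff_mul_le {K : Type*} [NormedField K] [IsUltrametricDist K]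
    {φ ψ : PowerSeries K} {C D ρ : ℝ} (hC : 0 ≤ C) (hD : 0 ≤ D) (hρ : 0 ≤ ρ)
    (hφ : ∀ k, ‖coeff k φ‖ ≤ C * ρ ^ k) (hψ : ∀ k, ‖coeff k ψ‖ ≤ D * ρ ^ k) (k : ℕ) :
    ‖coeff k (φ * ψ)‖ ≤ C * D * ρ ^ k := by
  rw [coeff_mul]
  refine IsUltrametricDist.norm_sum_le_of_forall_le_of_nonneg (by positivity) fun x hx => ?_
  rw [norm_mul, ← Finset.HasAntidiagonal.mem_antidiagonal.1 hx, pow_add, mul_mul_mul_comm]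
  exact mul_le_mul (hφ _) (hψ _) (norm_nonneg _) (by positivity)

theorem PowerSeries.norm_coeff_prod_le {K ι : Type*} [NormedField K] [IsUltrametricDist K]
    (s : Finset ι) {φ : ι → PowerSeries K} {C : ι → ℝ} {ρ : ℝ} (hC : ∀ i ∈ s, 0 ≤ C i)
    (hρ : 0 ≤ ρ) (hφ : ∀ i ∈ s, ∀ k, ‖coeff k (φ i)‖ ≤ C i * ρ ^ k) (k : ℕ) :
    ‖coeff k (∏ i ∈ s, φ i)‖ ≤ (∏ i ∈ s, C i) * ρ ^ k := by
  classical
  induction s using Finset.induction_on generalizing k with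
  | empty =>
    simp only [Finset.prod_empty, coeff_one]
    split_ifs with h
    · simp [h]
    · simpa using pow_nonneg hρ k
  | insert i s hi ih =>
    simp only [Finset.forall_mem_insert] at hC hφ
    rw [Finset.prod_insert hi, Finset.prod_insert hi]
    exact norm_coeff_mul_le hC.1 (Finset.prod_nonneg hC.2) hρ hφ.1 (ih hC.2 hφ.2) k

theorem PowerSeries.exists_inv_prod_X_add_C_pow {K ι : Type*} [NormedField K]
    [IsUltrametricDist K] (s : Finset ι) (c : ι → K) (T : ℕ) {ρ : ℝ} (hc : ∀ i ∈ s, c i ≠ 0)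
    (hρ : ∀ i ∈ s, ‖c i‖⁻¹ ≤ ρ) (hρ0 : 0 ≤ ρ) :
    ∃ b : PowerSeries K, (∏ i ∈ s, (X + C (c i)) ^ T) * b = 1 ∧
      ∀ k, ‖coeff k b‖ ≤ (∏ i ∈ s, ‖c i‖⁻¹) ^ T * ρ ^ k := by
  refine ⟨∏ i ∈ s, ∏ _j ∈ Finset.range T, (X + C (c i))⁻¹, ?_, ?_⟩
  · rw [← Finset.prod_mul_distrib]
    refine Finset.prod_eq_one fun i hi => ?_
    rw [Finset.prod_const, Finset.card_range, ← mul_pow, PowerSeries.mul_inv_cancel, one_pow]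
    simpa using hc i hi
  · rw [← Finset.prod_pow]
    refine norm_coeff_prod_le s (fun i _ => by positivity) hρ0 fun i hi => ?_
    have := norm_coeff_prod_le (K := K) (Finset.range T) (φ := fun _ => (X + C (c i))⁻¹)
      (C := fun _ => ‖c i‖⁻¹) (ρ := ρ) (fun _ _ => by positivity) hρ0 fun _ _ k => ?_
    · simpa using this
    have h1 : (X + C (c i))⁻¹ = mk fun n => (-1) ^ n * (c i)⁻¹ ^ (n + 1) := by
      rw [PowerSeries.inv_eq_iff_mul_eq_one (by simpa using hc i hi)]
      ext n
      rw [mul_add]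
      cases n with
      | zero => simp [hc i hi]
      | succ n =>
        simp [coeff_succ_mul_X, coeff_mul_C, coeff_one]
        field_simp [hc i hi]
        ring
    rw [h1, coeff_mk]
    simp only [norm_mul, norm_pow, norm_neg, norm_one, one_pow, one_mul, norm_inv, pow_succ']
    gcongr
    exact hρ i hi

open Polynomial in
theorem Polynomial.modByMonic_prod_X_sub_C_pow {K ι : Type*} [Field K] [DecidableEq ι]
    (s : Finset ι) (v : ι → K) (hv : Set.InjOn v s) (T : ℕ) (b : ι → PowerSeries K)
    (hb : ∀ i ∈ s, ((taylor (v i) (∏ j ∈ s.erase i, (X - C (v j)) ^ T) : K[X]) : PowerSeries K)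
      * b i = 1) (F : K[X]) :
    F %ₘ ∏ j ∈ s, (X - C (v j)) ^ T = ∑ i ∈ s, (∏ j ∈ s.erase i, (X - C (v j)) ^ T) *
      ∑ k ∈ Finset.range T,
        C (PowerSeries.coeff k ((taylor (v i) F : K[X]) * b i : PowerSeries K))
          * (X - C (v i)) ^ k := by
  set Q := ∏ j ∈ s, (X - C (v j)) ^ T with hQ
  have hQm : Q.Monic := monic_prod_of_monic _ _ fun j _ => (monic_X_sub_C _).pow T
  set q : ι → K[X] := fun i => ∏ j ∈ s.erase i, (X - C (v j)) ^ T with hq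
  have hqm : ∀ i, (q i).Monic := fun i => monic_prod_of_monic _ _ fun j _ => (monic_X_sub_C _).pow T
  set φ : ι → PowerSeries K := fun i => (taylor (v i) F : K[X]) * b i with hφ
  set L := ∑ i ∈ s, q i * ∑ k ∈ Finset.range T,
    C (PowerSeries.coeff k (φ i)) * (X - C (v i)) ^ k with hL
  have hdvd : Q ∣ F - L := by
    refine Finset.prod_dvd_of_coprime (fun i hi j hj hij => ?_) fun i hi => ?_
    · refine (isCoprime_X_sub_C_of_isUnit_sub ?_).pow
      exact (sub_ne_zero.2 fun h => hij (hv hi hj h)).isUnit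
    · rw [hL, ← Finset.add_sum_erase s _ hi, ← sub_sub]
      refine dvd_sub ?_ (Finset.dvd_sum fun j hj => Dvd.dvd.mul_right
        (Finset.dvd_prod_of_mem _ (Finset.mem_erase.2 ⟨(Finset.ne_of_mem_erase hj).symm, hi⟩)) _)
      have hte : ∀ G, taylorEquiv (v i) G = taylor (v i) G := fun _ => rfl
      have hX : taylorEquiv (v i) (X - C (v i)) = X := by simp [hte]
      have htr : taylorEquiv (v i) (∑ k ∈ Finset.range T,
          C (PowerSeries.coeff k (φ i)) * (X - C (v i)) ^ k) = PowerSeries.trunc T (φ i) := by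
        ext k
        simp [map_sum, hte, PowerSeries.coeff_trunc, coeff_X_pow]
      rw [← map_dvd_iff (taylorEquiv (v i)), map_pow, hX, map_sub, map_mul, htr, X_pow_dvd_iff]
      have h1 : ((taylorEquiv (v i) F - taylorEquiv (v i) (q i) * PowerSeries.trunc T (φ i) : K[X])
          : PowerSeries K) = (taylorEquiv (v i) (q i) : K[X]) *
            (φ i - ((PowerSeries.trunc T (φ i) : K[X]) : PowerSeries K)) := by
        have h2 : ((taylorEquiv (v i) F : K[X]) : PowerSeries K)
            = (taylorEquiv (v i) (q i) : K[X]) * φ i := by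
          have h3 : ((taylorEquiv (v i) (q i) : K[X]) : PowerSeries K) * b i = 1 := hb i hi
          calc _ = ((taylorEquiv (v i) F : K[X]) : PowerSeries K) *
                (((taylorEquiv (v i) (q i) : K[X]) : PowerSeries K) * b i) := by rw [h3, mul_one]
            _ = _ := by simp only [hφ, hte]; ring
        rw [Polynomial.coe_sub, Polynomial.coe_mul, h2, mul_sub]
      have h4 : PowerSeries.X ^ T ∣ φ i - ((PowerSeries.trunc T (φ i) : K[X]) : PowerSeries K) := by
        rw [PowerSeries.X_pow_dvd_iff]
        intro k hk
        simp [PowerSeries.coeff_trunc, hk]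
      have h5 := h1 ▸ Dvd.dvd.mul_left h4 _
      intro k hk
      simpa only [Polynomial.coeff_coe] using PowerSeries.X_pow_dvd_iff.1 h5 k hk
  have hdeg : L.degree < Q.degree := by
    rw [degree_eq_natDegree hQm.ne_zero, ← mem_degreeLT]
    refine Submodule.sum_mem _ fun i hi => ?_
    rw [Finset.mul_sum]
    refine Submodule.sum_mem _ fun k hk => ?_
    rw [mem_degreeLT, ← degree_eq_natDegree hQm.ne_zero, hQ, ← Finset.mul_prod_erase s _ hi,
      mul_comm ((X - C (v i)) ^ T), degree_mul, degree_mul (q := (X - C (v i)) ^ T)]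
    refine WithBot.add_lt_add_left (degree_ne_bot.2 (hqm i).ne_zero) ?_
    rw [degree_pow, degree_X_sub_C]
    calc _ ≤ ((X - C (v i)) ^ k).degree := smul_eq_C_mul (R := K) _ ▸ degree_smul_le _ _
      _ = (k : WithBot ℕ) := by rw [degree_pow, degree_X_sub_C]; simp
      _ < _ := by simpa using Finset.mem_range.1 hk
  obtain ⟨g, hg⟩ := hdvd
  exact (div_modByMonic_unique g L hQm ⟨by rw [← hg]; ring, hdeg⟩).2
theorem norm_natCast_eq_pow_padicValNat {p : ℕ} [Fact p.Prime] {K : Type*} [NormedField K]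
    [Algebra ℚ_[p] K] (hiso : ∀ x : ℚ_[p], ‖algebraMap ℚ_[p] K x‖ = ‖x‖) {n : ℕ} (hn : n ≠ 0) :
    ‖(n : K)‖⁻¹ = (p : ℝ) ^ padicValNat p n := by
  rw [norm_natCast_eq_norm_padic hiso, Padic.norm_eq_zpow_neg_valuation (by exact_mod_cast hn),
    Padic.valuation_natCast, ← zpow_neg, neg_neg, zpow_natCast]

theorem inv_norm_natCast_sub_natCast_le {p : ℕ} [hp : Fact p.Prime] {K : Type*} [NormedField K]
    [Algebra ℚ_[p] K] (hiso : ∀ x : ℚ_[p], ‖algebraMap ℚ_[p] K x‖ = ‖x‖) {S m j : ℕ}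
    (hm : m ≤ S) (hj : j ≤ S) (hmj : m ≠ j) :
    ‖(m : K) - j‖⁻¹ ≤ (p : ℝ) ^ Nat.log p S := by
  wlog h : j ≤ m generalizing m j
  · rw [norm_sub_rev]
    exact this hj hm hmj.symm (by omega)
  rw [← Nat.cast_sub h, norm_natCast_eq_pow_padicValNat hiso (by omega)]
  exact pow_le_pow_right₀ (by exact_mod_cast hp.out.one_le)
    ((padicValNat_le_nat_log _).trans (Nat.log_mono_right (by omega)))

theorem prod_erase_norm_natCast_sub_natCast {K : Type*} [NormedField K] {S m : ℕ} (hm : m ≤ S) :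
    ∏ j ∈ (Finset.range (S + 1)).erase m, ‖(m : K) - j‖
      = ‖(m.factorial : K)‖ * ‖((S - m).factorial : K)‖ := by
  obtain ⟨t, rfl⟩ := Nat.exists_eq_add_of_le hm
  have hs : (Finset.range (m + t + 1)).erase m = Finset.range m ∪ Finset.Ico (m + 1) (m + t + 1) := by
    ext j
    simp only [Finset.mem_erase, Finset.mem_range, Finset.mem_union, Finset.mem_Ico]
    omega
  have hd : Disjoint (Finset.range m) (Finset.Ico (m + 1) (m + t + 1)) := by
    refine Finset.disjoint_left.2 fun j hj hj' => ?_
    simp only [Finset.mem_range, Finset.mem_Ico] at hj hj'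
    omega
  rw [hs, Finset.prod_union hd, Finset.prod_Ico_eq_prod_range, Nat.add_sub_cancel_left,
    ← Nat.descFactorial_self m, Nat.descFactorial_eq_prod_range,
    ← Finset.prod_range_add_one_eq_factorial, Nat.cast_prod, Nat.cast_prod, norm_prod, norm_prod]
  congr 1
  · refine Finset.prod_congr rfl fun j hj => ?_
    rw [Nat.cast_sub (Finset.mem_range.1 hj).le]
  · rw [show m + t + 1 - (m + 1) = t by omega]
    refine Finset.prod_congr rfl fun j _ => ?_
    rw [norm_sub_rev]
    congr 1
    push_cast
    ring

theorem prod_erase_inv_norm_le {p : ℕ} [hp : Fact p.Prime] {K : Type*} [NormedField K]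
    [IsUltrametricDist K] [Algebra ℚ_[p] K]
    (hiso : ∀ x : ℚ_[p], ‖algebraMap ℚ_[p] K x‖ = ‖x‖) {S m : ℕ} (hm : m ≤ S) :
    ∏ j ∈ (Finset.range (S + 1)).erase m, ‖(m : K) - j‖⁻¹
      ≤ (p : ℝ) ^ padicValNat p S.factorial := by
  have : CharZero K := charZero_of_injective_algebraMap (algebraMap ℚ_[p] K).injective
  rw [Finset.prod_inv_distrib, prod_erase_norm_natCast_sub_natCast hm,
    ← norm_natCast_eq_pow_padicValNat hiso S.factorial_ne_zero]
  have h0 : 0 < ‖(S.factorial : K)‖ :=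
    norm_pos_iff.2 (by exact_mod_cast S.factorial_ne_zero)
  refine inv_anti₀ h0 ?_
  rw [← Nat.choose_mul_factorial_mul_factorial hm, Nat.cast_mul, Nat.cast_mul, norm_mul, norm_mul,
    mul_assoc]
  exact mul_le_of_le_one_left (by positivity) (IsUltrametricDist.norm_natCast_le_one K _)

open Polynomial in
theorem norm_aeval_int_le {K : Type*} [NormedField K] [IsUltrametricDist K] {R : ℝ} (hR : 1 ≤ R)
    {z : K} (hz : ‖z‖ ≤ R) {G : ℤ[X]} {d : ℕ} (hd : G.natDegree ≤ d) : ‖aeval z G‖ ≤ R ^ d := by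
  rw [aeval_eq_sum_range]
  refine IsUltrametricDist.norm_sum_le_of_forall_le_of_nonneg (by positivity) fun i hi => ?_
  rw [zsmul_eq_mul, norm_mul, norm_pow]
  calc _ ≤ 1 * ‖z‖ ^ i := by gcongr; exact IsUltrametricDist.norm_intCast_le_one K _
    _ ≤ R ^ i := by rw [one_mul]; gcongr
    _ ≤ R ^ d := pow_le_pow_right₀ hR (by have := Finset.mem_range.1 hi; omega)

open Polynomial in
theorem norm_aeval_X_pow_divByMonic_mul_le {K : Type*} [NormedField K] [IsUltrametricDist K]
    {R : ℝ} (hR : 1 ≤ R) {z : K} (hz : ‖z‖ ≤ R) {Q : ℤ[X]} (hQ : Q.Monic) (n : ℕ) :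
    ‖aeval z (X ^ n /ₘ Q)‖ * R ^ Q.natDegree ≤ R ^ n := by
  rcases lt_or_ge n Q.natDegree with h | h
  · rw [(divByMonic_eq_zero_iff hQ).2]
    · simp; positivity
    · rw [degree_X_pow, degree_eq_natDegree hQ.ne_zero]
      exact_mod_cast h
  · calc _ ≤ R ^ (n - Q.natDegree) * R ^ Q.natDegree := by
          gcongr
          exact norm_aeval_int_le hR hz (by rw [natDegree_divByMonic _ hQ, natDegree_X_pow])
      _ = R ^ n := by rw [← pow_add, Nat.sub_add_cancel h]

open Polynomial in
theorem Polynomial.coeff_taylor_X_pow {K : Type*} [CommRing K] (x : K) (n h : ℕ) :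
    (taylor x (X ^ n)).coeff h = n.choose h * x ^ (n - h) := by
  rw [taylor_X_pow, coeff_X_add_C_pow, mul_comm]

open Polynomial in
theorem pow_eq_hermite_interpolation_add {K : Type*} [Field K] [CharZero K] (S T : ℕ)
    (b : ℕ → PowerSeries K)
    (hb : ∀ m ∈ Finset.range (S + 1), (∏ j ∈ (Finset.range (S + 1)).erase m,
      (PowerSeries.X + PowerSeries.C ((m : K) - j)) ^ T) * b m = 1) (z : K) (n : ℕ) :
    z ^ n = ∑ m ∈ Finset.range (S + 1), (∏ j ∈ (Finset.range (S + 1)).erase m, (z - j) ^ T) *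
      ∑ k ∈ Finset.range T, (∑ x ∈ Finset.HasAntidiagonal.antidiagonal k,
        (n.choose x.1 * (m : K) ^ (n - x.1)) * PowerSeries.coeff x.2 (b m)) * (z - m) ^ k +
      (∏ j ∈ Finset.range (S + 1), (z - j) ^ T) *
        aeval z ((X : ℤ[X]) ^ n /ₘ ∏ j ∈ Finset.range (S + 1), (X - C (j : ℤ)) ^ T) := by
  have hQm : (∏ j ∈ Finset.range (S + 1), (X - C (j : ℤ)) ^ T).Monic :=
    monic_prod_of_monic _ _ fun j _ => (monic_X_sub_C _).pow T
  have h := modByMonic_prod_X_sub_C_pow (Finset.range (S + 1)) (fun j : ℕ => (j : K))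
    Nat.cast_injective.injOn T b (fun i hi => ?_) (X ^ n)
  · have h1 := congrArg (eval z) (modByMonic_add_div (X ^ n : K[X])
      (∏ j ∈ Finset.range (S + 1), (X - C (j : K)) ^ T))
    have h2 : (X ^ n : K[X]) /ₘ (∏ j ∈ Finset.range (S + 1), (X - C (j : K)) ^ T) =
        (X ^ n /ₘ ∏ j ∈ Finset.range (S + 1), (X - C (j : ℤ)) ^ T).map (Int.castRingHom K) := by
      rw [map_divByMonic _ hQm]
      simp [Polynomial.map_prod]
    rw [h, h2] at h1
    simp only [eval_add, eval_mul, eval_finsetSum, eval_prod, eval_pow, eval_sub, eval_X,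
      eval_C, PowerSeries.coeff_mul, Polynomial.coeff_coe, coeff_taylor_X_pow] at h1
    rw [aeval_def, ← h1, eval_map]
    rfl
  · rw [← hb i hi]
    congr 1
    change ((taylorAlgHom (i : K) (∏ j ∈ (Finset.range (S + 1)).erase i,
      (X - C (j : K)) ^ T) : K[X]) : PowerSeries K) = _
    rw [map_prod, ← coeToPowerSeries.ringHom_apply, map_prod]
    refine Finset.prod_congr rfl fun j _ => ?_
    rw [map_pow, map_pow, coeToPowerSeries.ringHom_apply]
    congr 1
    change ((taylor (i : K) (X - C (j : K)) : K[X]) : PowerSeries K) = _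
    rw [map_sub (taylor _), taylor_X, taylor_C, coe_sub, coe_add, coe_X, coe_C, coe_C,
      map_sub, add_sub_assoc]

theorem norm_tsum_mul_pow_le_of_hermite_data {p : ℕ} [hp : Fact p.Prime] {K : Type*}
    [NormedField K] [IsUltrametricDist K] [CompleteSpace K] [Algebra ℚ_[p] K]
    (hiso : ∀ x : ℚ_[p], ‖algebraMap ℚ_[p] K x‖ = ‖x‖) (S T : ℕ) {R r : ℝ} (hr : 1 ≤ r)
    (hR : r ≤ R) {a : ℕ → K} (ha : Tendsto (fun n => ‖a n‖ * R ^ n) atTop (𝓝 0)) {D G : ℝ}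
    (hD0 : 0 ≤ D) (hG0 : 0 ≤ G)
    (hD : ∀ m ≤ S, ∀ h < T, ‖∑' n, (n.choose h : K) * a n * (m : K) ^ (n - h)‖ ≤ D)
    (hG : ∀ n, ‖a n‖ * R ^ n ≤ G) {z : K} (hz : ‖z‖ ≤ r) :
    ‖∑' n, a n * z ^ n‖ ≤ r ^ ((S + 1) * T) *
      max ((p : ℝ) ^ ((padicValNat p S.factorial + Nat.log p S) * T) * D)
        ((1 / R) ^ ((S + 1) * T) * G) := by
  have : CharZero K := charZero_of_injective_algebraMap (algebraMap ℚ_[p] K).injective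
  have hp1 : (1 : ℝ) ≤ p := by exact_mod_cast hp.out.one_le
  have hR1 := hr.trans hR
  have hbex : ∀ m : ℕ, ∃ b : PowerSeries K, m ∈ Finset.range (S + 1) →
      (∏ j ∈ (Finset.range (S + 1)).erase m,
        (PowerSeries.X + PowerSeries.C ((m : K) - j)) ^ T) * b = 1 ∧
      ∀ k, ‖PowerSeries.coeff k b‖ ≤ ((p : ℝ) ^ padicValNat p S.factorial) ^ T *
        ((p : ℝ) ^ Nat.log p S) ^ k := by
    intro m
    by_cases hm : m ∈ Finset.range (S + 1)
    · have hm' := Finset.mem_range_succ_iff.1 hm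
      obtain ⟨b, hb, hb'⟩ := PowerSeries.exists_inv_prod_X_add_C_pow
        ((Finset.range (S + 1)).erase m) (fun j => (m : K) - j) T (ρ := (p : ℝ) ^ Nat.log p S)
        (fun j hj => sub_ne_zero.2 (by exact_mod_cast (Finset.ne_of_mem_erase hj).symm))
        (fun j hj => inv_norm_natCast_sub_natCast_le hiso hm'
          (Finset.mem_range_succ_iff.1 (Finset.mem_of_mem_erase hj))
          (Finset.ne_of_mem_erase hj).symm) (by positivity)
      refine ⟨b, fun _ => ⟨hb, fun k => (hb' k).trans ?_⟩⟩
      gcongr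
      exact prod_erase_inv_norm_le hiso hm'
    · exact ⟨0, fun h => absurd h hm⟩
  choose b hb using hbex
  have hQm : (∏ j ∈ Finset.range (S + 1),
      (Polynomial.X - Polynomial.C (j : ℤ)) ^ T).Monic :=
    Polynomial.monic_prod_of_monic _ _ fun j _ => (Polynomial.monic_X_sub_C _).pow T
  have hQdeg : (∏ j ∈ Finset.range (S + 1),
      (Polynomial.X - Polynomial.C (j : ℤ)) ^ T).natDegree = (S + 1) * T := by
    rw [Polynomial.natDegree_prod_of_monic _ _ fun j _ => (Polynomial.monic_X_sub_C _).pow T]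
    simp only [Polynomial.natDegree_pow, Polynomial.natDegree_X_sub_C, Finset.sum_const,
      Finset.card_range, smul_eq_mul, mul_one]
  have hg := fun n => norm_aeval_X_pow_divByMonic_mul_le hR1 (hz.trans hR) hQm n
  have hpow := pow_eq_hermite_interpolation_add S T b (fun m hm => (hb m hm).1) z
  set Q := ∏ j ∈ Finset.range (S + 1), (Polynomial.X - Polynomial.C (j : ℤ)) ^ T with hQ
  set g : ℕ → K := fun n => Polynomial.aeval z (Polynomial.X ^ n /ₘ Q) with hgdef
  have hsg : Summable fun n => a n * g n := summable_mul_pow_of_tendsto ha fun n =>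
    (le_mul_of_one_le_right (norm_nonneg _) (one_le_pow₀ hR1)).trans (hg n)
  have hsd : ∀ m h : ℕ, Summable fun n => (n.choose h : K) * a n * (m : K) ^ (n - h) := by
    intro m h
    have := summable_mul_pow_of_tendsto ha
      (b := fun n => (n.choose h : K) * (m : K) ^ (n - h)) fun n => ?_
    · exact this.congr fun n => by ring
    · rw [← Nat.cast_pow, ← Nat.cast_mul]
      exact (IsUltrametricDist.norm_natCast_le_one K _).trans (one_le_pow₀ hR1)
  have hsum : HasSum (fun n => a n * z ^ n)
      (∑ m ∈ Finset.range (S + 1), (∏ j ∈ (Finset.range (S + 1)).erase m, (z - j) ^ T) *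
        ∑ k ∈ Finset.range T, (∑ x ∈ Finset.HasAntidiagonal.antidiagonal k,
          (∑' n, (n.choose x.1 : K) * a n * (m : K) ^ (n - x.1)) *
            PowerSeries.coeff x.2 (b m)) * (z - m) ^ k +
        (∏ j ∈ Finset.range (S + 1), (z - j) ^ T) * ∑' n, a n * g n) := by
    have := (hasSum_sum fun m (_ : m ∈ Finset.range (S + 1)) =>
      (hasSum_sum fun k (_ : k ∈ Finset.range T) =>
        (hasSum_sum fun x (_ : x ∈ Finset.HasAntidiagonal.antidiagonal k) =>
          ((hsd m x.1).hasSum.mul_right (PowerSeries.coeff x.2 (b m)))).mul_right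
            ((z - m) ^ k)).mul_left (∏ j ∈ (Finset.range (S + 1)).erase m, (z - j) ^ T)).add
      (hsg.hasSum.mul_left (∏ j ∈ Finset.range (S + 1), (z - j) ^ T))
    refine (funext fun n => ?_ : (fun n => a n * z ^ n) = _) ▸ this
    rw [hpow n, mul_add, Finset.mul_sum]
    congr 1
    · refine Finset.sum_congr rfl fun m _ => ?_
      rw [mul_left_comm, Finset.mul_sum]
      congr 1
      refine Finset.sum_congr rfl fun k _ => ?_
      rw [← mul_assoc, Finset.mul_sum]
      congr 1
      refine Finset.sum_congr rfl fun x _ => ?_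
      ring
    · ring
  have hzm : ∀ m : ℕ, ‖z - m‖ ≤ r := fun m => by
    rw [sub_eq_add_neg]
    refine (IsUltrametricDist.norm_add_le_max _ _).trans (max_le hz ?_)
    rw [norm_neg]
    exact (IsUltrametricDist.norm_natCast_le_one K _).trans hr
  have hprod : ∀ s : Finset ℕ, ‖∏ j ∈ s, (z - j) ^ T‖ ≤ r ^ (s.card * T) := fun s => by
    rw [norm_prod, mul_comm, pow_mul]
    refine (Finset.prod_le_prod (fun j _ => norm_nonneg _) fun j _ =>
      (norm_pow (z - (j : ℕ)) T).trans_le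
        (pow_le_pow_left₀ (norm_nonneg _) (hzm j) T)).trans_eq ?_
    rw [Finset.prod_const]
  rw [hsum.tsum_eq]
  refine (IsUltrametricDist.norm_add_le_max _ _).trans ?_
  rw [mul_max_of_nonneg _ _ (by positivity)]
  refine max_le_max ?_ ?_
  · refine IsUltrametricDist.norm_sum_le_of_forall_le_of_nonneg (by positivity) fun m hm => ?_
    rw [Finset.mul_sum]
    refine IsUltrametricDist.norm_sum_le_of_forall_le_of_nonneg (by positivity) fun k hk => ?_
    have hk' := Finset.mem_range.1 hk
    have h1 : ‖∑ x ∈ Finset.HasAntidiagonal.antidiagonal k,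
        (∑' n, (n.choose x.1 : K) * a n * (m : K) ^ (n - x.1)) * PowerSeries.coeff x.2 (b m)‖
        ≤ (p : ℝ) ^ ((padicValNat p S.factorial + Nat.log p S) * T) * D := by
      refine IsUltrametricDist.norm_sum_le_of_forall_le_of_nonneg (by positivity) fun x hx => ?_
      have hx' := Finset.HasAntidiagonal.mem_antidiagonal.1 hx
      rw [norm_mul, mul_comm]
      refine mul_le_mul (((hb m hm).2 _).trans ?_)
        (hD m (Finset.mem_range_succ_iff.1 hm) x.1 (by omega)) (norm_nonneg _) (by positivity)
      rw [add_mul, pow_add, pow_mul, pow_mul]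
      gcongr
      · exact one_le_pow₀ hp1
      · omega
    have h2 : ‖∏ j ∈ (Finset.range (S + 1)).erase m, (z - j) ^ T‖ ≤ r ^ (S * T) := by
      simpa [Finset.card_erase_of_mem hm] using hprod ((Finset.range (S + 1)).erase m)
    have h3 : ‖(z - m) ^ k‖ ≤ r ^ T := by
      rw [norm_pow]
      exact (pow_le_pow_left₀ (norm_nonneg _) (hzm m) k).trans (pow_le_pow_right₀ hr hk'.le)
    rw [norm_mul, norm_mul, add_mul, one_mul, pow_add r]
    calc _ ≤ r ^ (S * T) *
          ((p : ℝ) ^ ((padicValNat p S.factorial + Nat.log p S) * T) * D * r ^ T) := by gcongr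
      _ = _ := by ring
  · rw [norm_mul]
    refine mul_le_mul (by simpa using hprod (Finset.range (S + 1))) ?_ (norm_nonneg _)
      (by positivity)
    refine IsUltrametricDist.norm_tsum_le_of_forall_le_of_nonneg (by positivity) fun n => ?_
    rw [one_div_pow, one_div_mul_eq_div, le_div_iff₀ (by positivity), norm_mul, mul_assoc]
    refine le_trans ?_ (hG n)
    gcongr
    exact hQdeg ▸ hg n

theorem padicValNat_factorial_add_log_eq {p : ℕ} [hp : Fact p.Prime] (S : ℕ) :
    ((S : ℝ) - ((Nat.digits p S).sum : ℝ)) / ((p : ℝ) - 1) + (⌊Real.log S / Real.log p⌋ : ℝ)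
      = (padicValNat p S.factorial + Nat.log p S : ℕ) := by
  have hp1 : (1 : ℝ) < p := by exact_mod_cast hp.out.one_lt
  have h1 := congrArg (Nat.cast : ℕ → ℝ) (sub_one_mul_padicValNat_factorial (p := p) S)
  rw [Nat.cast_mul, Nat.cast_sub hp.out.one_le, Nat.cast_sub (Nat.digit_sum_le p S),
    Nat.cast_one] at h1
  rw [← h1, mul_div_cancel_left₀ _ (by linarith : (p : ℝ) - 1 ≠ 0), Real.log_div_log,
    Real.floor_logb_natCast (Nat.cast_nonneg S), Int.log_natCast]
  push_cast
  rfl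

/-- **`p`-adic interpolation lemma of Roy** (lemme 4.8, a special case of Roy's corollary 1.2,
conjectured by Robba).  Since `ℂ_p` is not available, the statement is phrased for an arbitrary
field `K` which, like `ℂ_p`, is a complete algebraically closed ultrametric normed field
equipped with an isometric embedding of `ℚ_p`.

Let `S₁, T₁ ≥ 1` be integers, `R ≥ r ≥ 1` real numbers and set
`κ = (S₁ − σ_p(S₁))/(p − 1) + ⌊log S₁ / log p⌋`, where `σ_p(S₁)` is the sum of the digits of
`S₁` in base `p`.  If `f : {‖z‖ ≤ R} → K` is analytic, i.e. given by a power series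
`∑ aₙ zⁿ` with `‖aₙ‖ Rⁿ → 0`, then
`|f|_r / r^{(S₁+1)T₁} ≤ p^{κT₁} · max( max_{0 ≤ m ≤ S₁, 0 ≤ h < T₁} |f^{(h)}(m)/h!| ,
R^{-(S₁+1)T₁} |f|_R )`, where the divided derivatives `f^{(h)}/h!` are obtained by termwise
differentiation of the series. -/
theorem padic_interpolation_lemma_roy (p : ℕ) [hp : Fact p.Prime]
    (K : Type*) [NormedField K] [IsUltrametricDist K] [CompleteSpace K] [IsAlgClosed K]
    [Algebra ℚ_[p] K] (hiso : ∀ x : ℚ_[p], ‖algebraMap ℚ_[p] K x‖ = ‖x‖)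
    (S₁ T₁ : ℕ) (hS : 1 ≤ S₁) (hT : 1 ≤ T₁) (R r : ℝ) (hr : 1 ≤ r) (hR : r ≤ R)
    (κ : ℝ)
    (hκ : κ = ((S₁ : ℝ) - ((Nat.digits p S₁).sum : ℝ)) / ((p : ℝ) - 1)
            + (⌊Real.log S₁ / Real.log p⌋ : ℝ))
    (a : ℕ → K) (ha : Filter.Tendsto (fun n => ‖a n‖ * R ^ n) Filter.atTop (nhds 0))
    (f : K → K) (hfdef : ∀ z : K, ‖z‖ ≤ R → f z = ∑' n : ℕ, a n * z ^ n) :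
    (⨆ z : {z : K // ‖z‖ ≤ r}, ‖f z‖) / r ^ ((S₁ + 1) * T₁) ≤
      (p : ℝ) ^ (κ * T₁) *
        max
          (⨆ m : Fin (S₁ + 1), ⨆ h : Fin T₁,
            ‖∑' n : ℕ, ((n.choose (h : ℕ) : K) * a n * (((m : ℕ) : K)) ^ (n - (h : ℕ)))‖)
          ((1 / R) ^ ((S₁ + 1) * T₁) * ⨆ z : {z : K // ‖z‖ ≤ R}, ‖f z‖) := by
  have hR1 := hr.trans hR
  have hR0 : 0 < R := by linarith
  have hG : ∀ n, ‖a n‖ * R ^ n ≤ ⨆ z : {z : K // ‖z‖ ≤ R}, ‖f z‖ := by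
    obtain ⟨A, hA⟩ := ha.bddAbove_range
    have hbdd : BddAbove (Set.range fun z : {z : K // ‖z‖ ≤ R} => ‖f z‖) := by
      refine ⟨A, ?_⟩
      rintro _ ⟨z, rfl⟩
      simp only
      rw [hfdef z z.2]
      refine IsUltrametricDist.norm_tsum_le_of_forall_le fun n => ?_
      refine le_trans ?_ (hA ⟨n, rfl⟩)
      rw [norm_mul, norm_pow]
      exact mul_le_mul_of_nonneg_left (pow_le_pow_left₀ (norm_nonneg _) z.2 n) (norm_nonneg _)
    exact norm_coeff_mul_pow_le_of_forall_closedBall hiso hR0 ha fun z hz =>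
      hfdef z hz ▸ le_ciSup hbdd ⟨z, hz⟩
  have hD : ∀ m ≤ S₁, ∀ h < T₁, ‖∑' n, (n.choose h : K) * a n * (m : K) ^ (n - h)‖ ≤
      ⨆ m : Fin (S₁ + 1), ⨆ h : Fin T₁,
        ‖∑' n : ℕ, ((n.choose (h : ℕ) : K) * a n * (((m : ℕ) : K)) ^ (n - (h : ℕ)))‖ :=
    fun m hm h hh => le_ciSup_of_le (Set.finite_range _).bddAbove
      (⟨m, Nat.lt_succ_of_le hm⟩ : Fin (S₁ + 1))
      (le_ciSup_of_le (Set.finite_range _).bddAbove (⟨h, hh⟩ : Fin T₁) le_rfl)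
  set D := ⨆ m : Fin (S₁ + 1), ⨆ h : Fin T₁,
    ‖∑' n : ℕ, ((n.choose (h : ℕ) : K) * a n * (((m : ℕ) : K)) ^ (n - (h : ℕ)))‖
  set G := ⨆ z : {z : K // ‖z‖ ≤ R}, ‖f z‖
  have hD0 : 0 ≤ D := (norm_nonneg _).trans (hD 0 (Nat.zero_le _) 0 hT)
  have hG0 : 0 ≤ G := (by positivity : 0 ≤ ‖a 0‖ * R ^ 0).trans (hG 0)
  have hp1 : (1 : ℝ) ≤ p := by exact_mod_cast hp.out.one_le
  rw [hκ, padicValNat_factorial_add_log_eq, ← Nat.cast_mul, Real.rpow_natCast,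
    div_le_iff₀ (by positivity), mul_max_of_nonneg _ _ (by positivity), mul_comm (max _ _),
    mul_max_of_nonneg _ _ (by positivity)]
  have : Nonempty {z : K // ‖z‖ ≤ r} := ⟨⟨0, by rw [norm_zero]; linarith⟩⟩
  refine ciSup_le fun z => ?_
  rw [hfdef z (z.2.trans hR)]
  refine (norm_tsum_mul_pow_le_of_hermite_data hiso S₁ T₁ hr hR ha hD0 hG0 hD hG z.2).trans ?_
  rw [mul_max_of_nonneg _ _ (by positivity)]
  exact max_le_max_left _ (mul_le_mul_of_nonneg_left
    (le_mul_of_one_le_left (by positivity) (one_le_pow₀ hp1)) (by positivity))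
end

section
/- There exists an absolute constant c ≥ 1 with the following property. Let p be a prime number, let D, D₀, D₀♭, T, S be integers ≥ 1 and let 𝔯 > 1 be a real number. For 0 ≤ λ₀ ≤ D₀ set P_{λ₀}(X) = δ_{D₀♭}(X; λ₀). Then h( ( (1/t₀!)·P_{λ₀}^{(t₀)}(s) )_{0 ≤ λ₀ ≤ D₀, 0 ≤ s ≤ S, 0 ≤ t₀ ≤ T} ) + (1/D)·log max{ |(1/t₀!)·P_{λ₀}^{(t₀)}(z)|_p : 0 ≤ λ₀ ≤ D₀, 0 ≤ t₀ ≤ T, z ∈ ℂ_p, |z|_p ≤ 𝔯 } ≤ c·( D₀·log(e + S/D₀♭) + min(D₀, T)·D₀♭ + (D₀/D)·log 𝔯 ). -/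
/-- The (logarithmic absolute) Weil height of a finite tuple of rational numbers:
`h(a) = ∑_v log max_i |a_i|_v`, the sum running over all places of `ℚ` (the archimedean
absolute value and the `p`-adic absolute values normalized by `|p|_p = p^{-1}`). -/
noncomputable def weilHeight {ι : Type*} [Fintype ι] (a : ι → ℚ) : ℝ :=
  Real.log (⨆ i, |(a i : ℝ)|) +
    ∑ᶠ p : Nat.Primes, Real.log (⨆ i, ((padicNorm (p : ℕ) (a i) : ℚ) : ℝ))

/-- The Matveev polynomial `δ_{D₀♭}(X; λ₀) = Δ_{D₀♭}(X)^q · Δ_r(X)`, where `q` and `r` are the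
quotient and the remainder of the Euclidean division of `λ₀` by `D₀♭`. -/
noncomputable def matveevPoly (D0b lam0 : ℕ) : Polynomial ℚ :=
  binomialPoly D0b ^ (lam0 / D0b) * binomialPoly (lam0 % D0b)

open Polynomial

theorem weilHeight_le {ι : Type*} [Fintype ι] (a : ι → ℚ) {N : ℕ} (hN : N ≠ 0)
    (hint : ∀ i, ∃ z : ℤ, (N : ℚ) * a i = z) {M : ℝ} (hM : 1 ≤ M)
    (habs : ∀ i, |(a i : ℝ)| ≤ M) :
    weilHeight a ≤ Real.log M + Real.log N := by
  have log_le {x y : ℝ} (hx : 0 ≤ x) (hy : 1 ≤ y) (hxy : x ≤ y) : Real.log x ≤ Real.log y := by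
    rcases hx.eq_or_lt with rfl | hx
    · simpa using Real.log_nonneg hy
    · exact Real.log_le_log hx hxy
  unfold weilHeight
  refine add_le_add (log_le (Real.iSup_nonneg fun i => abs_nonneg _) hM
    (Real.iSup_le habs (by linarith))) ?_
  have key (p : Nat.Primes) : Real.log (⨆ i, ((padicNorm (p : ℕ) (a i) : ℚ) : ℝ)) ≤
      (N.factorization p : ℝ) * Real.log p := by
    have : Fact (p : ℕ).Prime := ⟨p.2⟩
    have hp1 : (1 : ℝ) ≤ ((p : ℕ) : ℝ) ^ N.factorization p :=
      one_le_pow₀ (by exact_mod_cast p.2.one_le)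
    rw [← Real.log_pow]
    refine log_le (Real.iSup_nonneg fun i => by exact_mod_cast padicNorm.nonneg _) hp1
      (Real.iSup_le (fun i => ?_) (by linarith))
    obtain ⟨z, hz⟩ := hint i
    have h1 : padicNorm p N * padicNorm p (a i) ≤ 1 := by
      rw [← padicNorm.mul, hz]; exact padicNorm.of_int z
    have hpos : (0 : ℚ) < ((p : ℕ) : ℚ) ^ N.factorization p :=
      pow_pos (by exact_mod_cast p.2.pos) _
    have h2 : padicNorm p (N : ℚ) = (((p : ℕ) : ℚ) ^ N.factorization p)⁻¹ := by
      rw [padicNorm.eq_zpow_of_nonzero (by exact_mod_cast hN), padicValRat.of_nat,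
        Nat.factorization_def _ p.2, zpow_neg, zpow_natCast]
    rw [h2, inv_mul_le_iff₀ hpos, mul_one] at h1
    exact_mod_cast h1
  by_cases hfin : (Function.support fun p : Nat.Primes =>
      Real.log (⨆ i, ((padicNorm (p : ℕ) (a i) : ℚ) : ℝ))).Finite
  · rw [finsum_eq_sum _ hfin]
    refine (Finset.sum_le_sum fun p _ => key p).trans ?_
    refine (Finset.sum_map hfin.toFinset
      ⟨fun p : Nat.Primes => (p : ℕ), Nat.Primes.coe_nat_injective⟩
      fun p : ℕ => (N.factorization p : ℝ) * Real.log p).symm.trans_le ?_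
    rw [Real.log_nat_eq_sum_factorization, Finsupp.sum,
      ← Finset.sum_filter_add_sum_filter_not _ (fun p => p ∈ N.factorization.support)]
    have hzero (s : Finset ℕ) : ∑ p ∈ s with p ∉ N.factorization.support,
        (N.factorization p : ℝ) * Real.log p = 0 :=
      Finset.sum_eq_zero fun p hp => by
        rw [Finsupp.notMem_support_iff.mp (Finset.mem_filter.mp hp).2]; simp
    rw [hzero, add_zero]
    exact Finset.sum_le_sum_of_subset_of_nonneg (fun p hp => (Finset.mem_filter.mp hp).2)
      fun p _ _ => mul_nonneg (Nat.cast_nonneg _) (Real.log_natCast_nonneg _)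
  · rw [finsum_of_infinite_support hfin]
    exact Real.log_natCast_nonneg _

theorem binomialPoly_zero : binomialPoly 0 = 1 := by simp [binomialPoly]

theorem binomialPoly_succ (n : ℕ) :
    binomialPoly (n + 1) = binomialPoly n * (C ((n + 1 : ℚ)⁻¹) * (X + C (n : ℚ))) := by
  simp only [binomialPoly, smul_eq_C_mul, ascPochhammer_succ_right, Nat.factorial_succ,
    Nat.cast_mul, mul_inv, C_mul, Nat.cast_add, Nat.cast_one, map_natCast]
  ring

theorem binomialPoly_succ_eq_X_mul (n : ℕ) :
    binomialPoly (n + 1) = C ((n + 1 : ℚ)⁻¹) * X * (binomialPoly n).comp (X + 1) := by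
  simp only [binomialPoly, smul_eq_C_mul, ascPochhammer_succ_left, Nat.factorial_succ,
    Nat.cast_mul, mul_inv, C_mul, Nat.cast_add, Nat.cast_one, mul_comp, C_comp]
  ring

theorem binomialPoly_succ_comp_X_add_one (n : ℕ) :
    (binomialPoly (n + 1)).comp (X + 1) =
      binomialPoly (n + 1) + (binomialPoly n).comp (X + 1) := by
  have h : C ((n + 1 : ℚ)⁻¹) * (n + 1 : ℚ[X]) = 1 := by
    have : (n + 1 : ℚ[X]) = C (n + 1 : ℚ) := by simp
    rw [this, ← C_mul, inv_mul_cancel₀ (by positivity), C_1]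
  simp only [binomialPoly, smul_eq_C_mul, mul_comp, C_comp, ascPochhammer_succ_comp_X_add_one,
    Nat.factorial_succ, Nat.cast_mul, mul_inv, C_mul, Nat.cast_add, Nat.cast_one, nsmul_eq_mul]
  linear_combination (C ((n.factorial : ℚ)⁻¹) * (ascPochhammer ℚ n).comp (X + 1)) * h

theorem binomialPoly_comp_X_add_one_comp_mem_range {n d : ℕ}
    (hd : ∀ k, 1 ≤ k → k ≤ n → k ∣ d) :
    ((binomialPoly n).comp (X + 1)).comp (C (d : ℚ) * X) ∈
      (mapRingHom (Int.castRingHom ℚ)).range := by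
  induction n with
  | zero => simp [binomialPoly_zero]
  | succ n ih =>
    rw [binomialPoly_succ, mul_comp, mul_comp]
    refine mul_mem (ih fun k h1 h2 => hd k h1 (by omega)) ?_
    obtain ⟨m, hm⟩ := hd (n + 1) (by omega) le_rfl
    refine ⟨1 + C (m : ℤ) * X, ?_⟩
    have hn : (n + 1 : ℚ) ≠ 0 := by positivity
    have h : C ((n + 1 : ℚ)⁻¹) * (n + 1 : ℚ[X]) = 1 := by
      have : (n + 1 : ℚ[X]) = C (n + 1 : ℚ) := by simp
      rw [this, ← C_mul, inv_mul_cancel₀ hn, C_1]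
    rw [hm]
    simp only [coe_mapRingHom, map_X, mul_comp, add_comp, C_comp, X_comp, one_comp,
      natCast_comp, map_natCast, Nat.cast_mul, Nat.cast_add, Nat.cast_one, map_mul, map_add, map_one]
    linear_combination (-(1 + (m : ℚ[X]) * X)) * h

theorem taylor_binomialPoly_comp_mem_range {n d : ℕ} (hd : ∀ k, 1 ≤ k → k ≤ n → k ∣ d) (s : ℕ) :
    (taylor (s : ℚ) (binomialPoly n)).comp (C (d : ℚ) * X) ∈
      (mapRingHom (Int.castRingHom ℚ)).range := by
  induction s generalizing n with
  | zero =>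
    rcases n with _ | n
    · simp [binomialPoly_zero]
    · obtain ⟨m, hm⟩ := hd (n + 1) (by omega) le_rfl
      rw [Nat.cast_zero, taylor_zero, binomialPoly_succ_eq_X_mul, mul_comp]
      refine mul_mem ⟨C (m : ℤ) * X, ?_⟩
        (binomialPoly_comp_X_add_one_comp_mem_range fun k h1 h2 => hd k h1 (by omega))
      have hn : (n + 1 : ℚ) ≠ 0 := by positivity
      have h : (C ((n + 1 : ℚ)⁻¹) : ℚ[X]) * C (d : ℚ) = C (m : ℚ) := by
        rw [← C_mul, hm]; push_cast; field_simp
      simp only [coe_mapRingHom, Polynomial.map_mul, map_C, map_X, Int.coe_castRingHom,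
        Int.cast_natCast, mul_comp, C_comp, X_comp]
      rw [← mul_assoc, h]
  | succ s ih =>
    induction n with
    | zero => simp [binomialPoly_zero]
    | succ n ihn =>
      have hrec : taylor ((s + 1 : ℕ) : ℚ) (binomialPoly (n + 1)) =
          taylor (s : ℚ) (binomialPoly (n + 1)) + taylor ((s + 1 : ℕ) : ℚ) (binomialPoly n) := by
        have h1 (f : ℚ[X]) : taylor ((s + 1 : ℕ) : ℚ) f = taylor (s : ℚ) (f.comp (X + 1)) := by
          rw [← C_1, ← taylor_apply, taylor_taylor]; push_cast; rfl
        rw [h1, h1, binomialPoly_succ_comp_X_add_one, map_add]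
      rw [hrec, add_comp]
      exact add_mem (ih hd) (ihn fun k h1 h2 => hd k h1 (by omega))

theorem taylor_matveevPoly_comp_mem_range {b d : ℕ} (hb : 1 ≤ b)
    (hd : ∀ k, 1 ≤ k → k ≤ b → k ∣ d) (l s : ℕ) :
    (taylor (s : ℚ) (matveevPoly b l)).comp (C (d : ℚ) * X) ∈
      (mapRingHom (Int.castRingHom ℚ)).range := by
  rw [matveevPoly, taylor_mul, taylor_pow, mul_comp, pow_comp]
  exact mul_mem (pow_mem (taylor_binomialPoly_comp_mem_range hd s) _)
    (taylor_binomialPoly_comp_mem_range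
      (fun k h1 h2 => hd k h1 (h2.trans (Nat.mod_lt l hb).le)) s)

theorem exists_int_pow_mul_hasseDeriv_matveevPoly {b d : ℕ} (hb : 1 ≤ b)
    (hd : ∀ k, 1 ≤ k → k ≤ b → k ∣ d) (l s t : ℕ) :
    ∃ z : ℤ, (d : ℚ) ^ t * (hasseDeriv t (matveevPoly b l)).eval (s : ℚ) = z := by
  obtain ⟨f, hf⟩ := taylor_matveevPoly_comp_mem_range hb hd l s
  refine ⟨f.coeff t, ?_⟩
  have h := congrArg (fun g => coeff g t) hf
  simp only [coe_mapRingHom, coeff_map, comp_C_mul_X_coeff, taylor_coeff] at h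
  rw [mul_comm, ← h]
  rfl

/-- The numerator of `matveevPoly b l`, with natural number coefficients. -/
noncomputable def matveevNum (b l : ℕ) : ℕ[X] :=
  ascPochhammer ℕ b ^ (l / b) * ascPochhammer ℕ (l % b)

/-- The denominator of `matveevPoly b l`. -/
def matveevDen (b l : ℕ) : ℕ := b.factorial ^ (l / b) * (l % b).factorial

theorem matveevDen_pos (b l : ℕ) : 0 < matveevDen b l := by
  unfold matveevDen; positivity

theorem matveevPoly_eq (b l : ℕ) :
    matveevPoly b l = C ((matveevDen b l : ℚ)⁻¹) * (matveevNum b l).map (Nat.castRingHom ℚ) := by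
  simp only [matveevPoly, matveevDen, matveevNum, binomialPoly, smul_eq_C_mul,
    Polynomial.map_mul, Polynomial.map_pow, ascPochhammer_map, Nat.cast_mul, Nat.cast_pow, mul_inv,
    C_mul, mul_pow, ← inv_pow, C_pow]
  ring

theorem natDegree_matveevNum_le (b l : ℕ) : (matveevNum b l).natDegree ≤ l := by
  refine natDegree_mul_le.trans ?_
  refine (add_le_add natDegree_pow_le le_rfl).trans ?_
  rw [ascPochhammer_natDegree, ascPochhammer_natDegree, mul_comm, Nat.div_add_mod]

theorem hasseDeriv_map {R S : Type*} [Semiring R] [Semiring S] (f : R →+* S) (t : ℕ) (g : R[X]) :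
    hasseDeriv t (g.map f) = (hasseDeriv t g).map f := by
  ext i
  simp [hasseDeriv_coeff]

theorem hasseDeriv_matveevPoly (b l t : ℕ) :
    hasseDeriv t (matveevPoly b l) =
      C ((matveevDen b l : ℚ)⁻¹) * (hasseDeriv t (matveevNum b l)).map (Nat.castRingHom ℚ) := by
  rw [matveevPoly_eq, ← smul_eq_C_mul, map_smul, hasseDeriv_map, smul_eq_C_mul]

theorem iterate_derivative_eq (t : ℕ) (f : ℚ[X]) :
    derivative^[t] f = C (t.factorial : ℚ) * hasseDeriv t f := by
  rw [← factorial_smul_hasseDeriv, LinearMap.smul_apply, nsmul_eq_mul, C_eq_natCast]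

theorem eval_hasseDeriv_le (f : ℕ[X]) (s t : ℕ) :
    (hasseDeriv t f).eval s ≤ f.eval (s + 1) := by
  rw [← taylor_coeff, add_comm, ← taylor_eval, eval_eq_sum_range]
  simp only [one_pow, mul_one]
  by_cases h : t ∈ Finset.range ((taylor s f).natDegree + 1)
  · exact Finset.single_le_sum (f := fun i => (taylor s f).coeff i) (fun _ _ => Nat.zero_le _) h
  · rw [coeff_eq_zero_of_natDegree_lt (by simpa using h)]
    exact Nat.zero_le _

theorem ascFactorial_div_factorial_le {b n : ℕ} (hb : 1 ≤ b) (hn : n ≤ b) (s : ℕ) :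
    ((s + 1).ascFactorial n : ℝ) / n.factorial ≤ Real.exp b * (1 + s / b) ^ n := by
  have hb0 : (0 : ℝ) < b := by exact_mod_cast hb
  have h1 : ((s + 1).ascFactorial n : ℝ) ≤ (b * (1 + s / b)) ^ n := by
    have h : b * (1 + s / b : ℝ) = s + b := by field_simp; ring
    rw [h]
    exact_mod_cast (Nat.ascFactorial_le_pow_add s n).trans (Nat.pow_le_pow_left (by omega) n)
  calc ((s + 1).ascFactorial n : ℝ) / n.factorial
      ≤ (b * (1 + s / b)) ^ n / n.factorial := by gcongr
    _ = (b : ℝ) ^ n / n.factorial * (1 + s / b) ^ n := by rw [mul_pow]; ring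
    _ ≤ _ := by gcongr; exact Real.pow_div_factorial_le_exp _ hb0.le n

theorem eval_hasseDeriv_matveevPoly_nonneg (b l s t : ℕ) :
    0 ≤ (hasseDeriv t (matveevPoly b l)).eval (s : ℚ) := by
  rw [hasseDeriv_matveevPoly, eval_mul, eval_C, ← map_natCast (Nat.castRingHom ℚ) s, eval_map,
    eval₂_hom]
  simp only [eq_natCast]
  positivity

theorem eval_hasseDeriv_matveevPoly_le {b : ℕ} (hb : 1 ≤ b) (l s t : ℕ) :
    (((hasseDeriv t (matveevPoly b l)).eval (s : ℚ) : ℚ) : ℝ) ≤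
      Real.exp (l + b) * (1 + s / b) ^ l := by
  have h1 : (((hasseDeriv t (matveevPoly b l)).eval (s : ℚ) : ℚ) : ℝ) ≤
      (((s + 1).ascFactorial b : ℝ) / b.factorial) ^ (l / b) *
        (((s + 1).ascFactorial (l % b) : ℝ) / (l % b).factorial) := by
    rw [hasseDeriv_matveevPoly, eval_mul, eval_C, ← map_natCast (Nat.castRingHom ℚ) s, eval_map,
      eval₂_hom]
    have h := eval_hasseDeriv_le (matveevNum b l) s t
    have h2 : (matveevNum b l).eval (s + 1) =
        (s + 1).ascFactorial b ^ (l / b) * (s + 1).ascFactorial (l % b) := by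
      simp [matveevNum, ascPochhammer_nat_eq_ascFactorial]
    rw [h2] at h
    have h3 : (((hasseDeriv t (matveevNum b l)).eval s : ℕ) : ℝ) ≤
        ((s + 1).ascFactorial b : ℝ) ^ (l / b) * (s + 1).ascFactorial (l % b) := by
      exact_mod_cast h
    rw [div_pow, div_mul_div_comm, div_eq_inv_mul]
    simp only [eq_natCast, Rat.cast_mul, Rat.cast_inv, Rat.cast_natCast, Nat.cast_id]
    have h4 : (matveevDen b l : ℝ) = (b.factorial : ℝ) ^ (l / b) * (l % b).factorial := by
      simp [matveevDen]
    rw [h4]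
    gcongr
  have hdiv : b * (l / b) + l % b = l := Nat.div_add_mod l b
  refine h1.trans ((mul_le_mul (pow_le_pow_left₀ (by positivity)
    (ascFactorial_div_factorial_le hb le_rfl s) _)
    (ascFactorial_div_factorial_le hb (Nat.mod_lt l hb).le s) (by positivity)
    (by positivity)).trans ?_)
  have hE : Real.exp b ^ (l / b) * Real.exp b ≤ Real.exp (l + b) := by
    rw [← Real.exp_nat_mul, ← Real.exp_add]
    gcongr
    exact_mod_cast (mul_comm _ _).trans_le (Nat.mul_div_le l b)
  calc (Real.exp b * (1 + s / b : ℝ) ^ b) ^ (l / b) * (Real.exp b * (1 + s / b) ^ (l % b))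
      = (Real.exp b ^ (l / b) * Real.exp b) * (1 + s / b : ℝ) ^ (b * (l / b) + l % b) := by
        rw [mul_pow, ← pow_mul, pow_add]; ring
    _ ≤ _ := by rw [hdiv]; gcongr

section Ultrametric

variable {p : ℕ} [Fact p.Prime] {K : Type*} [NormedField K] [Algebra ℚ_[p] K]

theorem inv_norm_natCast_factorial_le
    (hK : ∀ x : ℚ_[p], ‖algebraMap ℚ_[p] K x‖ = ‖x‖) (n : ℕ) :
    ‖(n.factorial : K)‖⁻¹ ≤ 2 ^ n := by
  have hp : p.Prime := Fact.out
  rw [← map_natCast (algebraMap ℚ_[p] K), hK,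
    Padic.norm_eq_zpow_neg_valuation (by exact_mod_cast n.factorial_ne_zero),
    Padic.valuation_natCast, zpow_neg, inv_inv, zpow_natCast]
  have h1 := sub_one_mul_padicValNat_factorial (p := p) n
  have h2 : (p - 1) * padicValNat p n.factorial ≤ n := by omega
  have h3 : p ≤ 2 ^ (p - 1) := by
    have := Nat.lt_two_pow_self (n := p - 1)
    have := hp.one_lt
    omega
  have h4 : p ^ padicValNat p n.factorial ≤ 2 ^ n :=
    (Nat.pow_le_pow_left h3 _).trans (by
      rw [← pow_mul]; exact Nat.pow_le_pow_right (by norm_num) h2)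
  exact_mod_cast h4

theorem inv_norm_natCast_matveevDen_le
    (hK : ∀ x : ℚ_[p], ‖algebraMap ℚ_[p] K x‖ = ‖x‖) (b l : ℕ) :
    ‖(matveevDen b l : K)‖⁻¹ ≤ 2 ^ l := by
  rw [matveevDen, Nat.cast_mul, Nat.cast_pow, norm_mul, norm_pow, mul_inv, ← inv_pow]
  calc _ ≤ ((2 : ℝ) ^ b) ^ (l / b) * 2 ^ (l % b) := by
        gcongr <;> exact inv_norm_natCast_factorial_le hK _
    _ = 2 ^ l := by rw [← pow_mul, ← pow_add, Nat.div_add_mod]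

theorem norm_eval_map_natCast_le [IsUltrametricDist K] (f : ℕ[X]) {n : ℕ} (hf : f.natDegree ≤ n)
    {r : ℝ} (hr : 1 ≤ r) {z : K} (hz : ‖z‖ ≤ r) :
    ‖(f.map (Nat.castRingHom K)).eval z‖ ≤ r ^ n := by
  rw [eval_eq_sum_range]
  refine IsUltrametricDist.norm_sum_le_of_forall_le_of_nonneg (by positivity) fun i hi => ?_
  have hi' : i ≤ n := by
    have := natDegree_map_le (f := Nat.castRingHom K) (p := f)
    have := Finset.mem_range.mp hi
    omega
  rw [coeff_map, norm_mul, norm_pow]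
  calc _ ≤ 1 * r ^ i := by
        gcongr
        exact IsUltrametricDist.norm_natCast_le_one K _
    _ ≤ r ^ n := by rw [one_mul]; exact pow_le_pow_right₀ hr hi'

theorem norm_eval_hasseDeriv_matveevPoly_le [IsUltrametricDist K] [CharZero K]
    (hK : ∀ x : ℚ_[p], ‖algebraMap ℚ_[p] K x‖ = ‖x‖) (b l t : ℕ) {r : ℝ} (hr : 1 ≤ r) {z : K}
    (hz : ‖z‖ ≤ r) :
    ‖((hasseDeriv t (matveevPoly b l)).map (algebraMap ℚ K)).eval z‖ ≤ (2 * r) ^ l := by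
  have h : ((hasseDeriv t (matveevPoly b l)).map (algebraMap ℚ K)).eval z =
      (matveevDen b l : K)⁻¹ *
        ((hasseDeriv t (matveevNum b l)).map (Nat.castRingHom K)).eval z := by
    rw [hasseDeriv_matveevPoly, Polynomial.map_mul, Polynomial.map_map, map_C, eval_mul, eval_C,
      map_inv₀, map_natCast, Subsingleton.elim ((algebraMap ℚ K).comp (Nat.castRingHom ℚ))
        (Nat.castRingHom K)]
  rw [h, norm_mul, norm_inv, mul_pow]
  exact mul_le_mul (inv_norm_natCast_matveevDen_le hK b l)
    (norm_eval_map_natCast_le _ ((natDegree_hasseDeriv_le _ t).trans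
      ((Nat.sub_le _ _).trans (natDegree_matveevNum_le b l))) hr hz)
    (norm_nonneg _) (by positivity)

end Ultrametric

theorem weilHeight_matveevPoly_le {b : ℕ} (hb : 1 ≤ b) (D0 S T : ℕ) :
    weilHeight (fun x : Fin (D0 + 1) × Fin (S + 1) × Fin (T + 1) =>
        ((derivative^[(x.2.2 : ℕ)] (matveevPoly b (x.1 : ℕ))).eval
            (((x.2.1 : ℕ) : ℚ))) / ((x.2.2 : ℕ).factorial : ℚ)) ≤
      (D0 + b + D0 * Real.log (1 + S / b)) + (min D0 T : ℕ) * ((Real.log 4 + 4) * b) := by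
  have hb0 : (0 : ℝ) < b := by exact_mod_cast hb
  have hu : (1 : ℝ) ≤ 1 + S / b := by
    have : (0 : ℝ) ≤ S / b := by positivity
    linarith
  have heval (l s t : ℕ) : (derivative^[t] (matveevPoly b l)).eval (s : ℚ) / (t.factorial : ℚ) =
      (hasseDeriv t (matveevPoly b l)).eval (s : ℚ) := by
    rw [iterate_derivative_eq, eval_mul, eval_C, mul_div_cancel_left₀]
    exact_mod_cast t.factorial_ne_zero
  have hdvd : ∀ k, 1 ≤ k → k ≤ b → k ∣ Nat.lcmUpto b := fun k h1 h2 =>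
    Finset.dvd_lcm (f := id) (Finset.mem_Icc.mpr ⟨h1, h2⟩)
  simp only [heval]
  refine (weilHeight_le _ (N := Nat.lcmUpto b ^ min D0 T)
    (M := Real.exp (D0 + b) * (1 + S / b) ^ D0)
    (pow_ne_zero _ (Nat.lcmUpto_ne_zero b)) ?_ ?_ ?_).trans ?_
  · rintro ⟨l, s, t⟩
    rcases le_or_gt (t : ℕ) D0 with ht | ht
    · obtain ⟨z, hz⟩ := exists_int_pow_mul_hasseDeriv_matveevPoly hb hdvd l s t
      have hm : (t : ℕ) ≤ min D0 T := le_min ht (by omega)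
      refine ⟨(Nat.lcmUpto b : ℤ) ^ (min D0 T - t) * z, ?_⟩
      rw [← Nat.sub_add_cancel hm, pow_add]
      push_cast
      rw [← hz, Nat.sub_add_cancel hm, mul_assoc]
    · refine ⟨0, ?_⟩
      have hdeg : (matveevNum b l).natDegree < t :=
        (natDegree_matveevNum_le b l).trans_lt (by omega)
      simp [hasseDeriv_matveevPoly, hasseDeriv_eq_zero_of_lt_natDegree _ _ hdeg]
  · exact one_le_mul_of_one_le_of_one_le (Real.one_le_exp (by positivity)) (one_le_pow₀ hu)
  · rintro ⟨l, s, t⟩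
    rw [abs_of_nonneg (by exact_mod_cast eval_hasseDeriv_matveevPoly_nonneg b l s t)]
    refine (eval_hasseDeriv_matveevPoly_le hb l s t).trans ?_
    have hl : (l : ℕ) ≤ D0 := by omega
    have hs : (s : ℕ) ≤ S := by omega
    calc Real.exp ((l : ℕ) + b) * (1 + (s : ℕ) / b : ℝ) ^ (l : ℕ)
        ≤ Real.exp (D0 + b) * (1 + S / b) ^ (l : ℕ) := by gcongr
      _ ≤ _ := by gcongr
  · rw [Real.log_mul (by positivity) (by positivity), Real.log_exp, Real.log_pow, Nat.cast_pow,
      Real.log_pow, ← Chebyshev.psi_eq_log_lcmUpto]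
    gcongr
    exact Chebyshev.psi_le_const_mul_self hb0.le

/-- Ultrametric estimate for the weight of the family of Matveev polynomials
(lemme 3.8, second part).  Since `ℂ_p` is not available, the statement is phrased for an
arbitrary field `K` which, like `ℂ_p`, is a complete algebraically closed ultrametric normed
field equipped with an isometric embedding of `ℚ_p`.  There is an absolute constant `c ≥ 1`
such that, for all integers `D, D₀, D₀♭, T, S ≥ 1` and every real `𝔯 > 1`, with
`P_{λ₀} = δ_{D₀♭}(X; λ₀)`,
`h((P_{λ₀}^{(t₀)}(s)/t₀!)_{λ₀ ≤ D₀, s ≤ S, t₀ ≤ T})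
  + (1/D) log max_{λ₀ ≤ D₀, t₀ ≤ T, |z|_p ≤ 𝔯} |P_{λ₀}^{(t₀)}(z)/t₀!|_p
  ≤ c (D₀ log(e + S/D₀♭) + min(D₀,T) D₀♭ + (D₀/D) log 𝔯)`. -/
theorem matveev_weight_bound_padic :
    ∃ c : ℝ, 1 ≤ c ∧
      ∀ (p : ℕ) [Fact p.Prime]
        (K : Type) [NormedField K] [IsUltrametricDist K] [CompleteSpace K]
        [IsAlgClosed K] [CharZero K] [Algebra ℚ_[p] K],
        (∀ x : ℚ_[p], ‖algebraMap ℚ_[p] K x‖ = ‖x‖) →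
      ∀ D D0 D0b T S : ℕ, 1 ≤ D → 1 ≤ D0 → 1 ≤ D0b → 1 ≤ T → 1 ≤ S →
      ∀ 𝔯 : ℝ, 1 < 𝔯 →
      weilHeight (fun x : Fin (D0 + 1) × Fin (S + 1) × Fin (T + 1) =>
          ((Polynomial.derivative^[(x.2.2 : ℕ)] (matveevPoly D0b (x.1 : ℕ))).eval
              (((x.2.1 : ℕ) : ℚ))) / ((x.2.2 : ℕ).factorial : ℚ)) +
        (1 / (D : ℝ)) * Real.log (⨆ l : Fin (D0 + 1), ⨆ t : Fin (T + 1),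
          ⨆ z : {z : K // ‖z‖ ≤ 𝔯},
            ‖(((t : ℕ).factorial : K))⁻¹ *
              ((Polynomial.derivative^[(t : ℕ)] (matveevPoly D0b (l : ℕ))).map
                  (algebraMap ℚ K)).eval (z : K)‖) ≤
      c * ((D0 : ℝ) * Real.log (Real.exp 1 + (S : ℝ) / (D0b : ℝ)) +
            (min D0 T : ℕ) * (D0b : ℝ) +
            ((D0 : ℝ) / (D : ℝ)) * Real.log 𝔯) := by
  refine ⟨10, by norm_num, ?_⟩
  intro p _ K _ _ _ _ _ _ hK D D0 D0b T S hD hD0 hD0b hT hS 𝔯 h𝔯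
  have hheight := weilHeight_matveevPoly_le hD0b D0 S T
  have hD' : (1 : ℝ) ≤ D := by exact_mod_cast hD
  have hD0' : (1 : ℝ) ≤ D0 := by exact_mod_cast hD0
  have hb0 : (0 : ℝ) < D0b := by exact_mod_cast hD0b
  have hm : (1 : ℝ) ≤ (min D0 T : ℕ) := by exact_mod_cast le_min hD0 hT
  have hsup : (⨆ l : Fin (D0 + 1), ⨆ t : Fin (T + 1), ⨆ z : {z : K // ‖z‖ ≤ 𝔯},
      ‖(((t : ℕ).factorial : K))⁻¹ *
        ((derivative^[(t : ℕ)] (matveevPoly D0b (l : ℕ))).map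
          (algebraMap ℚ K)).eval (z : K)‖) ≤ (2 * 𝔯) ^ D0 := by
    have hpos : 0 ≤ (2 * 𝔯) ^ D0 := by positivity
    refine Real.iSup_le (fun l => Real.iSup_le (fun t => Real.iSup_le (fun z => ?_) hpos) hpos) hpos
    have ht : ((t : ℕ).factorial : K) ≠ 0 := by exact_mod_cast (t : ℕ).factorial_ne_zero
    rw [iterate_derivative_eq, Polynomial.map_mul, map_C, eval_mul, eval_C, map_natCast,
      inv_mul_cancel_left₀ ht]
    exact (norm_eval_hasseDeriv_matveevPoly_le hK D0b l t h𝔯.le z.2).trans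
      (pow_le_pow_right₀ (by linarith) (by omega))
  have hlog : Real.log (⨆ l : Fin (D0 + 1), ⨆ t : Fin (T + 1), ⨆ z : {z : K // ‖z‖ ≤ 𝔯},
      ‖(((t : ℕ).factorial : K))⁻¹ *
        ((derivative^[(t : ℕ)] (matveevPoly D0b (l : ℕ))).map
          (algebraMap ℚ K)).eval (z : K)‖) ≤ D0 * (Real.log 2 + Real.log 𝔯) := by
    rw [← Real.log_mul (by norm_num) (by linarith), ← Real.log_pow]
    have hnonneg : 0 ≤ (⨆ l : Fin (D0 + 1), ⨆ t : Fin (T + 1), ⨆ z : {z : K // ‖z‖ ≤ 𝔯},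
        ‖(((t : ℕ).factorial : K))⁻¹ *
          ((derivative^[(t : ℕ)] (matveevPoly D0b (l : ℕ))).map
            (algebraMap ℚ K)).eval (z : K)‖) :=
      Real.iSup_nonneg fun l => Real.iSup_nonneg fun t => Real.iSup_nonneg fun z => norm_nonneg _
    rcases hnonneg.eq_or_lt with h | h
    · rw [← h, Real.log_zero]
      exact Real.log_nonneg (one_le_pow₀ (by linarith))
    · exact Real.log_le_log h hsup
  have hlog2 : Real.log 2 < 0.7 := Real.log_two_lt_d9.trans (by norm_num)
  have hlog4 : Real.log 4 < 1.4 := by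
    rw [show (4 : ℝ) = 2 ^ 2 by norm_num, Real.log_pow]
    push_cast
    linarith
  have hr0 : 0 ≤ Real.log 𝔯 := Real.log_nonneg h𝔯.le
  have hSb : (0 : ℝ) ≤ S / D0b := by positivity
  have he : 1 ≤ Real.exp 1 := Real.one_le_exp zero_le_one
  have hL1 : 1 ≤ Real.log (Real.exp 1 + S / D0b) := by
    rw [Real.le_log_iff_exp_le (by positivity)]
    linarith
  have hLu : Real.log (1 + S / D0b) ≤ Real.log (Real.exp 1 + S / D0b) :=
    Real.log_le_log (by positivity) (by linarith)
  have hthird : 1 / (D : ℝ) * (D0 * (Real.log 2 + Real.log 𝔯)) ≤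
      D0 + D0 / D * Real.log 𝔯 := by
    have h1 : 1 / (D : ℝ) ≤ 1 := by rw [div_le_one (by positivity)]; exact hD'
    have h2 : 1 / (D : ℝ) * (D0 * Real.log 2) ≤ 1 * (D0 * 1) := by
      gcongr
      linarith
    calc 1 / (D : ℝ) * (D0 * (Real.log 2 + Real.log 𝔯))
        = 1 / (D : ℝ) * (D0 * Real.log 2) + D0 / D * Real.log 𝔯 := by ring
      _ ≤ _ := by linarith
  have hA : (D0 : ℝ) ≤ D0 * Real.log (Real.exp 1 + S / D0b) :=
    le_mul_of_one_le_right (by positivity) hL1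
  have hB : (D0 : ℝ) * Real.log (1 + S / D0b) ≤ D0 * Real.log (Real.exp 1 + S / D0b) := by
    gcongr
  have hmb : (D0b : ℝ) ≤ (min D0 T : ℕ) * D0b := le_mul_of_one_le_left hb0.le hm
  have hcheb : (min D0 T : ℕ) * ((Real.log 4 + 4) * (D0b : ℝ)) ≤
      6 * ((min D0 T : ℕ) * (D0b : ℝ)) := by
    rw [mul_left_comm]
    gcongr
    linarith
  have hX : (0 : ℝ) ≤ D0 / D * Real.log 𝔯 := by positivity
  have hfin := mul_le_mul_of_nonneg_left hlog (show (0 : ℝ) ≤ 1 / D by positivity)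
  linarith
end
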